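/- arXiv:2308.10332 — 5 statements merged into one kernel-verified Lean document; each statement's English description precedes it below -/
import Mathlib

section
/- For all α, β, r ∈ ℂ and all n, k ∈ ℕ with k ≤ n, one has Ŝ_{n,k}(α,β;r) = Σ_{j=0}^{k} C(n−j, n−k) · E_{n,j}(α,β;r); that is, each row of the modified generalized Stirling triangle is the binomial transform of the corresponding row of the generalized Eulerian triangle. -/
/-- Falling factorial with stride `α`: `(r)^{\underline{m},α} = ∏_{i=0}^{m-1} (r - iα)`. -/
noncomputable def ffall (r α : ℂ) (m : ℕ) : ℂ := ∏ i ∈ Finset.range m, (r - i * α)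

/-- Modified generalized Stirling numbers
`Ŝ_{n,k}(α,β;r) = Σ_{x=0}^{k} (−1)^{k−x} C(k,x) (βx+r)^{\underline{n},α}`. -/
noncomputable def Shat (α β r : ℂ) (n k : ℕ) : ℂ :=
  ∑ x ∈ Finset.range (k + 1), (-1) ^ (k - x) * (Nat.choose k x : ℂ) * ffall (β * x + r) α n

/-- Generalized Eulerian numbers
`E_{n,k}(α,β;r) = Σ_{x=0}^{k} (−1)^{k−x} C(n+1,k−x) (βx+r)^{\underline{n},α}`. -/
noncomputable def Egen (α β r : ℂ) (n k : ℕ) : ℂ :=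
  ∑ x ∈ Finset.range (k + 1), (-1) ^ (k - x) * (Nat.choose (n + 1) (k - x) : ℂ) * ffall (β * x + r) α n

/-- The coefficients of `(1 - X) ^ e` as a power series. -/
theorem PowerSeries.coeff_one_sub_X_pow {R : Type*} [CommRing R] (e i : ℕ) :
    PowerSeries.coeff i ((1 - PowerSeries.X : PowerSeries R) ^ e) = (-1) ^ i * (e.choose i : R) := by
  have h : (1 - PowerSeries.X : PowerSeries R) ^ e =
      PowerSeries.rescale (-1 : R) (((1 + Polynomial.X) ^ e : Polynomial R) : PowerSeries R) := by
    simp [PowerSeries.rescale_X, sub_eq_add_neg]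
  rw [h, PowerSeries.coeff_rescale, Polynomial.coeff_coe, Polynomial.coeff_one_add_X_pow]

/-- Comparison of coefficients in `(1 - X) ^ (k + (d + 1)) * (1 - X) ^ (-(d + 1)) = (1 - X) ^ k`. -/
theorem sum_neg_one_pow_mul_choose_mul_choose {R : Type*} [CommRing R] (d k m : ℕ) :
    ∑ i ∈ Finset.range (m + 1),
        (-1) ^ i * ((k + (d + 1)).choose i : R) * ((d + (m - i)).choose d : R) =
      (-1) ^ m * (k.choose m : R) := by
  have h := congrArg (PowerSeries.coeff m)
    (PowerSeries.one_sub_pow_add_mul_invOneSubPow_val_eq_one_sub_pow R k (d + 1))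
  rw [PowerSeries.coeff_mul, Finset.Nat.sum_antidiagonal_eq_sum_range_succ_mk,
    PowerSeries.invOneSubPow_val_succ_eq_mk_add_choose, PowerSeries.coeff_one_sub_X_pow] at h
  simpa only [PowerSeries.coeff_one_sub_X_pow, PowerSeries.coeff_mk] using h

/-- Each row of the modified generalized Stirling triangle is the binomial transform
of the corresponding row of the generalized Eulerian triangle:
`Ŝ_{n,k} = Σ_{j=0}^{k} C(n−j, n−k) E_{n,j}`. -/
theorem Shat_eq_binomial_transform_Egen (α β r : ℂ) (n k : ℕ) (hk : k ≤ n) :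
    Shat α β r n k =
      ∑ j ∈ Finset.range (k + 1), (Nat.choose (n - j) (n - k) : ℂ) * Egen α β r n j := by
  simp only [Shat, Egen, Finset.mul_sum]
  rw [Finset.sum_comm' (t' := Finset.range (k + 1)) (s' := fun x => Finset.Ico x (k + 1))
    (by intro x y; simp only [Finset.mem_range, Finset.mem_Ico]; omega)]
  refine Finset.sum_congr rfl fun x hx => ?_
  have hxk : x ≤ k := Finset.mem_range_succ_iff.mp hx
  have h := sum_neg_one_pow_mul_choose_mul_choose (R := ℂ) (n - k) k (k - x)
  rw [Nat.choose_symm hxk] at h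
  rw [← h, Finset.sum_Ico_eq_sum_range, Finset.sum_mul, Nat.sub_add_comm hxk]
  refine Finset.sum_congr rfl fun i hi => ?_
  have hi' : i ≤ k - x := Finset.mem_range_succ_iff.mp hi
  rw [show x + i - x = i by omega, show k + (n - k + 1) = n + 1 by omega,
    show n - k + (k - x - i) = n - (x + i) by omega]
  ring
end

section
/- For all α, β, r ∈ ℂ and all n, k ∈ ℕ, the generalized Eulerian numbers satisfy the triangular (GKP-type) recurrence E_{n+1,k+1}(α,β;r) = (−αn + β(k+1) + r) · E_{n,k+1}(α,β;r) + ((α+β)n − βk + (β − r)) · E_{n,k}(α,β;r). -/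
theorem ffall_succ (r α : ℂ) (n : ℕ) : ffall r α (n + 1) = ffall r α n * (r - n * α) := by
  simp [ffall, Finset.prod_range_succ]

theorem cast_choose_succ_mul_succ (n j : ℕ) :
    (Nat.choose n (j + 1) : ℂ) * (j + 1) = Nat.choose n j * (n - j) := by
  rcases le_or_gt j n with h | h
  · rw [← Nat.cast_sub h]
    exact_mod_cast Nat.choose_succ_right_eq n j
  · simp [Nat.choose_eq_zero_of_lt h, Nat.choose_eq_zero_of_lt (Nat.lt_succ_of_lt h)]

/-- GKP-type triangular recurrence for the generalized Eulerian numbers: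
`E_{n+1,k+1} = (−αn + β(k+1) + r) E_{n,k+1} + ((α+β)n − βk + (β − r)) E_{n,k}`. -/
theorem Egen_recurrence (α β r : ℂ) (n k : ℕ) :
    Egen α β r (n + 1) (k + 1) =
      (-(α * n) + β * (k + 1) + r) * Egen α β r n (k + 1)
        + ((α + β) * n - β * k + (β - r)) * Egen α β r n k := by
  unfold Egen
  rw [Finset.sum_range_succ _ (k + 1), Finset.sum_range_succ _ (k + 1), mul_add,
    Finset.mul_sum, Finset.mul_sum, add_right_comm (Finset.sum _ _), ← Finset.sum_add_distrib]
  congr 1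
  · refine Finset.sum_congr rfl fun x hx => ?_
    obtain ⟨j, rfl⟩ := Nat.exists_eq_add_of_le (Nat.lt_succ_iff.mp (Finset.mem_range.mp hx))
    have h := cast_choose_succ_mul_succ (n + 1) j
    rw [show x + j + 1 - x = j + 1 by lia, show x + j - x = j by lia,
      Nat.choose_succ_succ (n + 1) j, ffall_succ]
    push_cast at h ⊢
    linear_combination β * (-1) ^ j * ffall (β * x + r) α n * h
  · simp only [ffall_succ, Nat.sub_self, Nat.choose_zero_right]
    push_cast
    ring
end

section
/- For all α, β, r ∈ ℂ and all n, k ∈ ℕ, the modified generalized Stirling numbers satisfy the two difference equations on the third parameter: Ŝ_{n+1,k}(α,β; r+α) − Ŝ_{n+1,k}(α,β; r) = α(n+1) · Ŝ_{n,k}(α,β; r), and Ŝ_{n,k}(α,β; r+β) − Ŝ_{n,k}(α,β; r) = Ŝ_{n,k+1}(α,β; r). -/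
theorem ffall_add_stride_succ (s α : ℂ) (n : ℕ) :
    ffall (s + α) α (n + 1) = (s + α) * ffall s α n := by
  unfold ffall
  rw [Finset.prod_range_succ', mul_comm]
  congr 1
  · simp
  · refine Finset.prod_congr rfl fun i _ => ?_
    push_cast
    ring

theorem ffall_add_stride_sub (s α : ℂ) (n : ℕ) :
    ffall (s + α) α (n + 1) - ffall s α (n + 1) = α * (n + 1) * ffall s α n := by
  have h : ffall s α (n + 1) = ffall s α n * (s - n * α) := Finset.prod_range_succ _ _
  rw [ffall_add_stride_succ, h]
  ring

theorem Shat_eq_fwdDiff_iter (α β r : ℂ) (n k : ℕ) :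
    Shat α β r n k = (fwdDiff β)^[k] (fun s => ffall s α n) r := by
  rw [fwdDiff_iter_eq_sum_shift]
  refine Finset.sum_congr rfl fun x _ => ?_
  rw [zsmul_eq_mul, nsmul_eq_mul, mul_comm β, add_comm]
  push_cast
  rfl

/-- Difference equations on the third parameter for the modified generalized
Stirling numbers:
`Ŝ_{n+1,k}(r+α) − Ŝ_{n+1,k}(r) = α(n+1) Ŝ_{n,k}(r)` and
`Ŝ_{n,k}(r+β) − Ŝ_{n,k}(r) = Ŝ_{n,k+1}(r)`. -/
theorem Shat_difference_equations (α β r : ℂ) (n k : ℕ) :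
    Shat α β (r + α) (n + 1) k - Shat α β r (n + 1) k = α * (n + 1) * Shat α β r n k ∧
    Shat α β (r + β) n k - Shat α β r n k = Shat α β r n (k + 1) := by
  constructor
  · unfold Shat
    rw [← Finset.sum_sub_distrib, Finset.mul_sum]
    refine Finset.sum_congr rfl fun x _ => ?_
    rw [← mul_sub, ← add_assoc, ffall_add_stride_sub]
    ring
  · simp only [Shat_eq_fwdDiff_iter, Function.iterate_succ_apply', fwdDiff]
end

section
/- For all n, k ∈ ℕ with k ≤ n, the Bessel numbers of the second kind satisfy the closed form S_{n,k}(1, 2; 0) = 2^{−(n−k)} · (n!/k!) · C(k, n−k), where C(k, n−k) is the binomial coefficient (equal to 0 when n−k > k); the identity is between complex numbers. -/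
/-- The Hsu–Shiue generalized Stirling numbers `S_{n,k}(α,β;r)`, defined by the
triangular recurrence `S_{0,0} = 1`, `S_{0,k+1} = 0`, `S_{n+1,0} = (r − αn) S_{n,0}`,
`S_{n+1,k+1} = (−αn + β(k+1) + r) S_{n,k+1} + S_{n,k}` (whence `S_{n,k} = 0` for `k > n`). -/
noncomputable def HS (α β r : ℂ) : ℕ → ℕ → ℂ
  | 0, 0 => 1
  | 0, _ + 1 => 0
  | n + 1, 0 => (r - α * n) * HS α β r n 0
  | n + 1, k + 1 => (-(α * n) + β * (k + 1) + r) * HS α β r n (k + 1) + HS α β r n k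

/-- The numbers `S_{n,k}(α,β;r)` vanish above the diagonal. -/
theorem HS_eq_zero_of_lt (α β r : ℂ) : ∀ {n k : ℕ}, n < k → HS α β r n k = 0
  | 0, k + 1, _ => by simp [HS]
  | n + 1, k + 1, h => by
    rw [HS, HS_eq_zero_of_lt α β r (show n < k + 1 by omega),
      HS_eq_zero_of_lt α β r (show n < k by omega)]
    simp

theorem cast_choose_succ_right_eq (m d : ℕ) :
    (Nat.choose m (d + 1) : ℂ) * (d + 1) = Nat.choose m d * (m - d) := by
  rcases le_or_gt d m with h | h
  · rw [← Nat.cast_sub h]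
    exact_mod_cast Nat.choose_succ_right_eq m d
  · simp [Nat.choose_eq_zero_of_lt h, Nat.choose_eq_zero_of_lt (Nat.lt_succ_of_lt h)]

/-- Closed form for the Bessel numbers of the second kind:
`S_{n,k}(1, 2; 0) = 2^{−(n−k)} (n!/k!) C(k, n−k)`. -/
theorem HS_Bessel_second_kind (n k : ℕ) (hk : k ≤ n) :
    HS 1 2 0 n k =
      ((2 : ℂ) ^ (n - k))⁻¹ * ((Nat.factorial n : ℂ) / (Nat.factorial k : ℂ))
        * (Nat.choose k (n - k) : ℂ) := by
  induction n generalizing k with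
  | zero =>
    obtain rfl : k = 0 := by omega
    simp [HS]
  | succ n ih =>
    cases k with
    | zero =>
      cases n with
      | zero => simp [HS]
      | succ n =>
        rw [HS, ih 0 (by omega)]
        simp
    | succ k =>
      rcases (Nat.le_of_succ_le_succ hk).eq_or_lt with rfl | h
      · rw [HS, HS_eq_zero_of_lt 1 2 0 (Nat.lt_succ_self k), ih k le_rfl]
        simp [Nat.factorial_ne_zero]
      · obtain ⟨d, rfl⟩ := Nat.exists_eq_add_of_le (show k + 1 ≤ n from h)
        rw [HS, ih (k + 1) (by omega), ih k (by omega)]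
        rw [show k + 1 + d - (k + 1) = d by omega, show k + 1 + d - k = d + 1 by omega,
          show k + 1 + d + 1 - (k + 1) = d + 1 by omega]
        have hright := cast_choose_succ_right_eq (k + 1) d
        have hdiag : ((k : ℂ) + 1) * Nat.choose k d = Nat.choose (k + 1) (d + 1) * (d + 1) := by
          exact_mod_cast Nat.add_one_mul_choose_eq k d
        have hpascal : (Nat.choose (k + 1) (d + 1) : ℂ) =
            Nat.choose k d + Nat.choose k (d + 1) := by
          exact_mod_cast Nat.choose_succ_succ' k d
        have hk1 : (k : ℂ) + 1 ≠ 0 := Nat.cast_add_one_ne_zero k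
        have hfac : (Nat.factorial k : ℂ) ≠ 0 := by exact_mod_cast Nat.factorial_ne_zero k
        rw [Nat.factorial_succ (k + 1 + d), Nat.factorial_succ k]
        push_cast at hright ⊢
        generalize (Nat.choose (k + 1) (d + 1) : ℂ) = c at *
        field_simp
        linear_combination (2 ^ d * (Nat.factorial (k + 1 + d) : ℂ)) *
          ((-2) * hright - hdiag - (k + 1 : ℂ) * hpascal)
end

section
/- For all n, k, p ∈ ℕ with k ≤ n and all ζ ∈ {0, 1}, one has E_{n,k}(−1, 2; 2−ζ+2p) = n! · C(n+1, 2k+2p+1−ζ) − (−1)^{k+p} Σ_{ℓ=0}^{p−1} (−1)^{ℓ} · (2−ζ+2ℓ)^{\overline{n}} · C(n+1, k+p−ℓ), where (m)^{\overline{n}} = m(m+1)⋯(m+n−1) is the rising factorial and the sum is empty when p = 0; the identity is between complex numbers. -/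
/-- Rising factorial with stride `α`: `(r)^{\overline{m},α} = ∏_{i=0}^{m-1} (r + iα)`. -/
noncomputable def frise (r α : ℂ) (m : ℕ) : ℂ := ∏ i ∈ Finset.range m, (r + i * α)

lemma ffall_neg_one_eq_frise (r : ℂ) (m : ℕ) : ffall r (-1) m = frise r 1 m := by
  simp [ffall, frise]

lemma frise_natCast_add_one (j n : ℕ) :
    frise ((j : ℂ) + 1) 1 n = (n.factorial : ℂ) * ((n + j).choose n : ℂ) := by
  have h : frise ((j : ℂ) + 1) 1 n = (((j + 1).ascFactorial n : ℕ) : ℂ) := by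
    rw [Nat.ascFactorial_eq_prod_range, frise]
    push_cast
    simp
  rw [h, Nat.ascFactorial_eq_factorial_mul_choose, Nat.cast_mul, add_comm j n, Nat.choose_symm_add]

open PowerSeries in
lemma sum_neg_one_pow_mul_choose_mul_choose_s18 (n N M : ℕ) (hM : M / 2 = N) :
    ∑ i ∈ Finset.range (N + 1),
      (-1 : ℂ) ^ i * ((n + 1).choose i : ℂ) * ((n + (M - 2 * i)).choose n : ℂ)
      = ((n + 1).choose M : ℂ) := by
  have key : (1 - X ^ 2 : ℂ⟦X⟧) ^ (n + 1) * PowerSeries.mk (fun j => ((n + j).choose n : ℂ))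
      = (1 + X) ^ (n + 1) := by
    have h := PowerSeries.mk_add_choose_mul_one_sub_pow_eq_one ℂ n
    calc _ = (1 + X : ℂ⟦X⟧) ^ (n + 1) *
          (PowerSeries.mk (fun j => ((n + j).choose n : ℂ)) * (1 - X) ^ (n + 1)) := by
          rw [show (1 - X ^ 2 : ℂ⟦X⟧) = (1 + X) * (1 - X) by ring, mul_pow]
          ring
      _ = _ := by rw [h, mul_one]
  have hr : coeff M ((1 + X : ℂ⟦X⟧) ^ (n + 1)) = ((n + 1).choose M : ℂ) := by
    have h := Polynomial.coeff_one_add_X_pow ℂ (n + 1) M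
    rw [← Polynomial.coeff_coe] at h
    simpa using h
  have hexp : (1 - X ^ 2 : ℂ⟦X⟧) ^ (n + 1)
      = ∑ i ∈ Finset.range (n + 2),
          PowerSeries.C ((-1 : ℂ) ^ i * ((n + 1).choose i : ℂ)) * X ^ (2 * i) := by
    rw [sub_eq_neg_add, add_pow]
    refine Finset.sum_congr rfl fun i _ => ?_
    rw [neg_pow, ← pow_mul]
    simp
    ring
  rw [← hr, ← key, hexp, Finset.sum_mul, map_sum]
  have hterm : ∀ i, coeff M (PowerSeries.C ((-1 : ℂ) ^ i * ((n + 1).choose i : ℂ)) * X ^ (2 * i)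
        * PowerSeries.mk (fun j => ((n + j).choose n : ℂ)))
      = if 2 * i ≤ M then
          (-1 : ℂ) ^ i * ((n + 1).choose i : ℂ) * ((n + (M - 2 * i)).choose n : ℂ) else 0 := by
    intro i
    rw [mul_assoc, coeff_C_mul, coeff_X_pow_mul']
    simp
  simp_rw [hterm]
  trans ∑ i ∈ Finset.range (N + 1 + (n + 2)), if 2 * i ≤ M then
      (-1 : ℂ) ^ i * ((n + 1).choose i : ℂ) * ((n + (M - 2 * i)).choose n : ℂ) else 0
  · rw [← Finset.sum_subset (Finset.range_mono (Nat.le_add_right (N + 1) (n + 2)))]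
    · refine Finset.sum_congr rfl fun i hi => ?_
      rw [Finset.mem_range] at hi
      rw [if_pos (by omega)]
    · intro i _ hi
      rw [Finset.mem_range] at hi
      rw [if_neg (by omega)]
  · symm
    refine Finset.sum_subset (Finset.range_mono (Nat.le_add_left (n + 2) (N + 1))) ?_
    intro i _ hi
    rw [Finset.mem_range] at hi
    rw [Nat.choose_eq_zero_of_lt (show n + 1 < i by omega)]
    simp

lemma sum_neg_one_pow_mul_choose_mul_frise (n N ζ : ℕ) (hζ : ζ = 0 ∨ ζ = 1) :
    ∑ y ∈ Finset.range (N + 1),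
      (-1 : ℂ) ^ (N - y) * ((n + 1).choose (N - y) : ℂ) * frise (2 - (ζ : ℂ) + 2 * y) 1 n
      = (n.factorial : ℂ) * ((n + 1).choose (2 * N + 1 - ζ) : ℂ) := by
  rw [← sum_neg_one_pow_mul_choose_mul_choose_s18 n N (2 * N + 1 - ζ) (by omega), Finset.mul_sum,
    ← Finset.sum_range_reflect]
  refine Finset.sum_congr rfl fun i hi => ?_
  rw [Finset.mem_range] at hi
  obtain ⟨d, rfl⟩ : ∃ d, N = i + d := ⟨N - i, by omega⟩
  rw [show i + d + 1 - 1 - i = d by omega, show i + d - d = i by omega,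
    show 2 * (i + d) + 1 - ζ - 2 * i = 2 * d + 1 - ζ by omega]
  have h : (2 - (ζ : ℂ) + 2 * (d : ℂ)) = ((2 * d + 1 - ζ : ℕ) : ℂ) + 1 := by
    rw [Nat.cast_sub (by omega)]
    push_cast
    ring
  rw [h, frise_natCast_add_one]
  ring

/-- For `ζ ∈ {0,1}` and `p ∈ ℕ`:
`E_{n,k}(−1, 2; 2−ζ+2p) = n! C(n+1, 2k+2p+1−ζ)
  − (−1)^{k+p} Σ_{ℓ=0}^{p−1} (−1)^ℓ (2−ζ+2ℓ)^{\overline{n}} C(n+1, k+p−ℓ)`. -/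
theorem Egen_neg_one_two_general (n k p ζ : ℕ) (hk : k ≤ n) (hζ : ζ = 0 ∨ ζ = 1) :
    Egen (-1) 2 (2 - (ζ : ℂ) + 2 * p) n k =
      (Nat.factorial n : ℂ) * (Nat.choose (n + 1) (2 * k + 2 * p + 1 - ζ) : ℂ)
        - (-1) ^ (k + p) * ∑ ℓ ∈ Finset.range p,
            (-1) ^ ℓ * frise (2 - (ζ : ℂ) + 2 * ℓ) 1 n
              * (Nat.choose (n + 1) (k + p - ℓ) : ℂ) := by
  have h := sum_neg_one_pow_mul_choose_mul_frise n (k + p) ζ hζ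
  rw [show k + p + 1 = p + (k + 1) by ring, Finset.sum_range_add] at h
  rw [show 2 * k + 2 * p + 1 - ζ = 2 * (k + p) + 1 - ζ by ring_nf, ← h, Egen, Finset.mul_sum]
  have h₁ : ∀ ℓ ∈ Finset.range p,
      (-1 : ℂ) ^ (k + p) * ((-1) ^ ℓ * frise (2 - (ζ : ℂ) + 2 * ℓ) 1 n
        * (Nat.choose (n + 1) (k + p - ℓ) : ℂ))
      = (-1 : ℂ) ^ (k + p - ℓ) * ((n + 1).choose (k + p - ℓ) : ℂ)
        * frise (2 - (ζ : ℂ) + 2 * ℓ) 1 n := by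
    intro ℓ hℓ
    rw [Finset.mem_range] at hℓ
    obtain ⟨d, hd⟩ : ∃ d, k + p = ℓ + d := ⟨k + p - ℓ, by omega⟩
    rw [hd, Nat.add_sub_cancel_left, pow_add]
    have hs : (-1 : ℂ) ^ ℓ * (-1) ^ ℓ = 1 := by rw [← mul_pow]; simp
    linear_combination (-1 : ℂ) ^ d * frise (2 - (ζ : ℂ) + 2 * ℓ) 1 n
      * ((n + 1).choose d : ℂ) * hs
  rw [Finset.sum_congr rfl h₁, add_sub_cancel_left]
  refine Finset.sum_congr rfl fun x _ => ?_
  rw [ffall_neg_one_eq_frise, show k + p - (p + x) = k - x by omega]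
  congr 2
  push_cast
  ring
end
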